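/- Let G = (V, E) be a finite graph with a fixed orientation (u_e, v_e) of each edge e ∈ E, and let k be a natural number. Let F(G) be the Boolean formula over the variables {x_v : v ∈ V} ∪ {y_e : e ∈ E} ∪ {z_e : e ∈ E} consisting, for each edge e ∈ E, of the two clauses (y_e ∨ ¬z_e ∨ x_{u_e}) and (z_e ∨ ¬y_e ∨ x_{v_e}). Let s be the assignment setting all variables to 0 and t the assignment setting x_v = 0 for all v ∈ V and y_e = z_e = 1 for all e ∈ E; both s and t satisfy F(G). Then G has a vertex cover of size at most k if and only if there exists a valid flip sequence from s to t of length at most 2|E| + 2k. -/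

import Mathlib

/-- A flip is a variable together with the value it flips *to*:
`(i, true)` is the positive flip `xᵢ⁺` (0→1), `(i, false)` the negative flip `xᵢ⁻` (1→0). -/
abbrev Flip (α : Type) := α × Bool

/-- Apply a flip to an assignment. -/
def applyFlip {α : Type} [DecidableEq α] (a : α → Bool) (f : Flip α) : α → Bool :=
  Function.update a f.1 f.2

/-- Apply a flip sequence (left to right) to an assignment; `applySeq s F` is `F(s)`. -/
def applySeq {α : Type} [DecidableEq α] (s : α → Bool) (F : List (Flip α)) : α → Bool :=
  F.foldl applyFlip s

/-- `ValidSeq R s F`: the flip sequence `F` is valid at `s` with respect to `R`, i.e.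
each flip in turn is applicable and every intermediate assignment (including `s` and
the final one) lies in `R`. -/
def ValidSeq {α : Type} [DecidableEq α] (R : Set (α → Bool)) :
    (α → Bool) → List (Flip α) → Prop
  | s, [] => s ∈ R
  | s, f :: F => s ∈ R ∧ s f.1 = !f.2 ∧ ValidSeq R (applyFlip s f) F

/-- The satisfying assignments of the formula `F(G)`: for each edge `e = (u_e, v_e)` the
clauses `(y_e ∨ ¬z_e ∨ x_{u_e})` and `(z_e ∨ ¬y_e ∨ x_{v_e})`, over the variables
`x_w (w ∈ V)`, `y_e, z_e (e ∈ E)` encoded as `V ⊕ E ⊕ E`. -/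
def coverSat {V E : Type} (u v : E → V) (a : (V ⊕ E ⊕ E) → Bool) : Prop :=
  ∀ e : E,
    (a (.inr (.inl e)) = true ∨ a (.inr (.inr e)) = false ∨ a (.inl (u e)) = true) ∧
    (a (.inr (.inr e)) = true ∨ a (.inr (.inl e)) = false ∨ a (.inl (v e)) = true)

section FlipSequences

variable {α : Type} [DecidableEq α] {R : Set (α → Bool)}

theorem ValidSeq.mem {s : α → Bool} {F : List (Flip α)} (h : ValidSeq R s F) : s ∈ R := by
  cases F with
  | nil => exact h
  | cons f F => exact h.1

theorem ValidSeq.append {s : α → Bool} {F G : List (Flip α)} (hF : ValidSeq R s F)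
    (hG : ValidSeq R (applySeq s F) G) : ValidSeq R s (F ++ G) := by
  induction F generalizing s with
  | nil => exact hG
  | cons f F ih => exact ⟨hF.1, hF.2.1, ih hF.2.2 hG⟩

/-- The number of flips of the variable `i` in a flip sequence. -/
def flipCount (F : List (Flip α)) (i : α) : ℕ := (F.map Prod.fst).count i

theorem flipCount_eq_zero {F : List (Flip α)} {i : α} :
    flipCount F i = 0 ↔ i ∉ F.map Prod.fst :=
  List.count_eq_zero

theorem sum_flipCount [Fintype α] (F : List (Flip α)) : ∑ i, flipCount F i = F.length := by
  simpa [flipCount] using Multiset.sum_count_eq_card (s := Finset.univ)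
    (m := (F.map Prod.fst : Multiset α)) fun _ _ => Finset.mem_univ _

/-- The value of a variable after a valid flip sequence is determined by the parity of the
number of its flips. -/
theorem ValidSeq.apply_eq_xor {s : α → Bool} {F : List (Flip α)} (h : ValidSeq R s F) (i : α) :
    applySeq s F i = (s i ^^ decide (flipCount F i % 2 = 1)) := by
  induction F generalizing s with
  | nil => simp [applySeq, flipCount]
  | cons f F ih =>
    have hstep : applySeq s (f :: F) = applySeq (applyFlip s f) F := rfl
    rw [hstep, ih h.2.2, flipCount, flipCount, List.map_cons, List.count_cons]
    have hf := h.2.1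
    by_cases hi : f.1 = i
    · subst hi
      have hparity : ((F.map Prod.fst).count f.1 + 1) % 2 = 1 ↔
          ¬ (F.map Prod.fst).count f.1 % 2 = 1 := by omega
      simp only [applyFlip, Function.update_self, beq_self_eq_true, if_true, hparity, hf]
      by_cases hc : (F.map Prod.fst).count f.1 % 2 = 1 <;> simp [hc]
    · simp [applyFlip, Function.update_of_ne (Ne.symm hi), hi]

/-- `b` is reached from `a` by a valid flip sequence of length `n`. -/
def FlipReach (R : Set (α → Bool)) (n : ℕ) (a b : α → Bool) : Prop :=
  ∃ F : List (Flip α), ValidSeq R a F ∧ applySeq a F = b ∧ F.length = n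

theorem FlipReach.refl {a : α → Bool} (ha : a ∈ R) : FlipReach R 0 a a :=
  ⟨[], ha, rfl, rfl⟩

theorem FlipReach.trans {a b c : α → Bool} {m n : ℕ} (hab : FlipReach R m a b)
    (hbc : FlipReach R n b c) : FlipReach R (m + n) a c := by
  obtain ⟨F, hF, rfl, rfl⟩ := hab
  obtain ⟨G, hG, rfl, rfl⟩ := hbc
  exact ⟨F ++ G, hF.append hG, by simp [applySeq], by simp⟩

theorem FlipReach.single {a b : α → Bool} (i : α) (ha : a ∈ R) (hb : b ∈ R)
    (hi : a i ≠ b i) (hne : ∀ j, j ≠ i → a j = b j) : FlipReach R 1 a b := by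
  have hab : applyFlip a (i, b i) = b := by
    funext j
    by_cases hj : j = i
    · subst hj; simp [applyFlip]
    · simp [applyFlip, hj, hne j hj]
  refine ⟨[(i, b i)], ⟨ha, by simpa [Bool.eq_not] using hi, ?_⟩, hab, rfl⟩
  rw [hab]
  exact hb

end FlipSequences

section VertexCover

theorem coverSat.eq_of_endpoints_false {V E : Type} {u v : E → V}
    {a : V ⊕ E ⊕ E → Bool} (ha : coverSat u v a) {e : E}
    (hu : a (.inl (u e)) = false) (hv : a (.inl (v e)) = false) :
    a (.inr (.inl e)) = a (.inr (.inr e)) := by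
  have h := ha e
  rw [hu, hv] at h
  cases hy : a (.inr (.inl e)) <;> cases hz : a (.inr (.inr e)) <;> simp_all

variable {V E : Type} [DecidableEq V] [DecidableEq E] {u v : E → V}

/-- The assignment whose true variables are the `x_w` with `w ∈ T`, the `y_e` with `e ∈ A` and
the `z_e` with `e ∈ B`. -/
def coverAssignment (T : Finset V) (A B : Finset E) : V ⊕ E ⊕ E → Bool :=
  Sum.elim (fun w => decide (w ∈ T)) (Sum.elim (fun e => decide (e ∈ A)) (fun e => decide (e ∈ B)))

theorem coverSat_coverAssignment_iff {T : Finset V} {A B : Finset E} :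
    coverSat u v (coverAssignment T A B) ↔
      ∀ e, (e ∈ A ∨ e ∉ B ∨ u e ∈ T) ∧ (e ∈ B ∨ e ∉ A ∨ v e ∈ T) := by
  simp [coverSat, coverAssignment]

theorem coverSat_coverAssignment_self (T : Finset V) (A : Finset E) :
    coverSat u v (coverAssignment T A A) :=
  coverSat_coverAssignment_iff.2 fun e => by tauto

theorem flipReach_raise_vertices (A : Finset E) (T : Finset V) :
    FlipReach {a | coverSat u v a} T.card (coverAssignment ∅ A A) (coverAssignment T A A) := by
  induction T using Finset.induction_on with
  | empty => exact .refl (coverSat_coverAssignment_self _ _)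
  | insert w T hw ih =>
    rw [Finset.card_insert_of_notMem hw]
    refine ih.trans (.single (.inl w) (coverSat_coverAssignment_self _ _)
      (coverSat_coverAssignment_self _ _) (by simp [coverAssignment, hw]) ?_)
    rintro (x | e | e) hj <;> simp_all [coverAssignment]

theorem flipReach_lower_vertices (A : Finset E) (T : Finset V) :
    FlipReach {a | coverSat u v a} T.card (coverAssignment T A A) (coverAssignment ∅ A A) := by
  induction T using Finset.induction_on with
  | empty => exact .refl (coverSat_coverAssignment_self _ _)
  | insert w T hw ih =>
    rw [Finset.card_insert_of_notMem hw, add_comm]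
    refine FlipReach.trans (.single (.inl w) (coverSat_coverAssignment_self _ _)
      (coverSat_coverAssignment_self _ _) (by simp [coverAssignment, hw]) ?_) ih
    rintro (x | e | e) hj <;> simp_all [coverAssignment]

theorem flipReach_raise_edges {S : Finset V} (hS : ∀ e, u e ∈ S ∨ v e ∈ S) (A : Finset E) :
    FlipReach {a | coverSat u v a} (2 * A.card)
      (coverAssignment S ∅ ∅) (coverAssignment S A A) := by
  induction A using Finset.induction_on with
  | empty => exact .refl (coverSat_coverAssignment_self _ _)
  | insert e A he ih =>
    rw [Finset.card_insert_of_notMem he, Nat.mul_succ]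
    refine ih.trans ?_
    rcases hS e with hu | hv
    · have hmid : coverSat u v (coverAssignment S A (insert e A)) := by
        refine coverSat_coverAssignment_iff.2 fun e' => ?_
        by_cases h : e' = e
        · subst h; simp [hu]
        · simp [h]; tauto
      refine FlipReach.trans (m := 1) (n := 1)
        (.single (.inr (.inr e)) (coverSat_coverAssignment_self _ _) hmid
          (by simp [coverAssignment, he]) ?_)
        (.single (.inr (.inl e)) hmid (coverSat_coverAssignment_self _ _)
          (by simp [coverAssignment, he]) ?_) <;>
      rintro (x | e' | e') hj <;> simp_all [coverAssignment]
    · have hmid : coverSat u v (coverAssignment S (insert e A) A) := by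
        refine coverSat_coverAssignment_iff.2 fun e' => ?_
        by_cases h : e' = e
        · subst h; simp [hv]
        · simp [h]; tauto
      refine FlipReach.trans (m := 1) (n := 1)
        (.single (.inr (.inl e)) (coverSat_coverAssignment_self _ _) hmid
          (by simp [coverAssignment, he]) ?_)
        (.single (.inr (.inr e)) hmid (coverSat_coverAssignment_self _ _)
          (by simp [coverAssignment, he]) ?_) <;>
      rintro (x | e' | e') hj <;> simp_all [coverAssignment]

/-- While both endpoint variables of `e` stay false, `y_e` cannot be flipped. -/
theorem ValidSeq.apply_edge_eq {s : V ⊕ E ⊕ E → Bool} {F : List (Flip (V ⊕ E ⊕ E))}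
    (h : ValidSeq {a | coverSat u v a} s F) {e : E}
    (hu : s (.inl (u e)) = false) (hv : s (.inl (v e)) = false)
    (hFu : .inl (u e) ∉ F.map Prod.fst) (hFv : .inl (v e) ∉ F.map Prod.fst) :
    applySeq s F (.inr (.inl e)) = s (.inr (.inl e)) := by
  induction F generalizing s with
  | nil => rfl
  | cons f F ih =>
    simp only [List.map_cons, List.mem_cons, not_or] at hFu hFv
    obtain ⟨hs, hf, hF⟩ := h
    have hu' : applyFlip s f (.inl (u e)) = false := by
      rw [applyFlip, Function.update_of_ne hFu.1, hu]
    have hv' : applyFlip s f (.inl (v e)) = false := by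
      rw [applyFlip, Function.update_of_ne hFv.1, hv]
    refine (ih hF hu' hv' hFu.2 hFv.2).trans ?_
    have hyz := coverSat.eq_of_endpoints_false hs hu hv
    have hyz' := coverSat.eq_of_endpoints_false hF.mem hu' hv'
    by_cases hfe : f.1 = .inr (.inl e)
    · rw [hfe] at hf
      simp [applyFlip, hfe, ← hyz, hf] at hyz'
    · rw [applyFlip, Function.update_of_ne (Ne.symm hfe)]

end VertexCover

/-- For a finite graph `G` with oriented edges `e = (u e, v e)`, with `s` the all-zero
assignment and `t` the assignment setting exactly the `y_e` and `z_e` variables to `1`: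
`s` and `t` satisfy `F(G)`, and `G` has a vertex cover of size at most `k` iff there is a
valid flip sequence from `s` to `t` of length at most `2|E| + 2k`. -/
theorem vertexCover_iff_short_flipSeq (V E : Type) [Fintype V] [Fintype E]
    [DecidableEq V] [DecidableEq E] (u v : E → V) (hloopless : ∀ e : E, u e ≠ v e)
    (k : ℕ) :
    coverSat u v (fun _ => false) ∧
    coverSat u v (Sum.elim (fun _ => false) (fun _ => true)) ∧
    ((∃ S : Finset V, (∀ e : E, u e ∈ S ∨ v e ∈ S) ∧ S.card ≤ k) ↔
      ∃ F : List (Flip (V ⊕ E ⊕ E)),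
        ValidSeq {a | coverSat u v a} (fun _ => false) F ∧
        applySeq (fun _ => false) F = Sum.elim (fun _ => false) (fun _ => true) ∧
        F.length ≤ 2 * Fintype.card E + 2 * k) := by
  have hs : (fun _ => false : V ⊕ E ⊕ E → Bool) = coverAssignment ∅ ∅ ∅ := by
    funext i
    rcases i with w | e | e <;> simp [coverAssignment]
  have ht : (Sum.elim (fun _ => false) (fun _ => true) : V ⊕ E ⊕ E → Bool) =
      coverAssignment ∅ Finset.univ Finset.univ := by
    funext i
    rcases i with w | e | e <;> simp [coverAssignment]
  refine ⟨hs ▸ coverSat_coverAssignment_self _ _, ht ▸ coverSat_coverAssignment_self _ _, ?_, ?_⟩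
  · rintro ⟨S, hS, hcard⟩
    obtain ⟨F, hF, hFt, hlen⟩ := ((flipReach_raise_vertices ∅ S).trans
      (flipReach_raise_edges hS Finset.univ)).trans (flipReach_lower_vertices Finset.univ S)
    refine ⟨F, hs ▸ hF, by rw [hs, ht, hFt], ?_⟩
    rw [hlen, Finset.card_univ]
    omega
  · rintro ⟨F, hF, hFt, hlen⟩
    have hpar := fun i => (hF.apply_eq_xor i).symm.trans (congrFun hFt i)
    have hy (e : E) : 1 ≤ flipCount F (.inr (.inl e)) := by
      have hodd : flipCount F (.inr (.inl e)) % 2 = 1 := by simpa using hpar (.inr (.inl e))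
      omega
    have hz (e : E) : 1 ≤ flipCount F (.inr (.inr e)) := by
      have hodd : flipCount F (.inr (.inr e)) % 2 = 1 := by simpa using hpar (.inr (.inr e))
      omega
    refine ⟨Finset.univ.filter fun w => flipCount F (.inl w) ≠ 0, fun e => ?_, ?_⟩
    · by_contra hcov
      simp only [Finset.mem_filter, Finset.mem_univ, true_and, not_or, not_not,
        flipCount_eq_zero] at hcov
      have := hF.apply_edge_eq rfl rfl hcov.1 hcov.2
      rw [hFt] at this
      simp at this
    · have hx (w : V) :
          (if flipCount F (.inl w) ≠ 0 then 2 else 0) ≤ flipCount F (.inl w) := by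
        have heven : flipCount F (.inl w) % 2 = 0 := by simpa using hpar (.inl w)
        split_ifs <;> omega
      have hsum := sum_flipCount F
      rw [Fintype.sum_sum_type, Fintype.sum_sum_type] at hsum
      have hX := Finset.sum_le_sum fun w (_ : w ∈ Finset.univ) => hx w
      have hY := Finset.sum_le_sum fun e (_ : e ∈ Finset.univ) => hy e
      have hZ := Finset.sum_le_sum fun e (_ : e ∈ Finset.univ) => hz e
      rw [← Finset.sum_filter, Finset.sum_const, smul_eq_mul] at hX
      rw [Finset.sum_const, smul_eq_mul, mul_one, Finset.card_univ] at hY hZ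
      omega
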